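/- In the clique removal process on (G, H) — where G ⊆ K^r_n with |G| = φ·binom(n,r), H ⊆ K^r_q(G) with |H(e)| = (1 ± n^{-ε})θ·binom(n,q-r) for all e ∈ G, ε < 0.4, θ ≥ n^{-1/3}, φ ≥ n^{-r/3}, and n sufficiently large — there exists a set H' ⊆ H of pairwise edge-disjoint q-cliques such that every (r-1)-subset of [n] lies in at most 3n^{1 - ε/(3k)} edges of G \ ∪H', where k = binom(q,r). -/

import Mathlib

open Finset

/-- One step of a supermartingale: if a quantity `X` loses `ℓ Q` and the average loss is at least
`a * X`, then the exponential moment of `X`, rescaled from `u` to `u'`, does not increase. -/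
theorem sum_exp_upper_step {β : Type*} (T : Finset β) (h : ℝ) (hT : (#T : ℝ) ≤ h) (ℓ : β → ℝ)
    {X M a μ lam u u' : ℝ} (hX : 0 ≤ X) (hl0 : ∀ Q ∈ T, 0 ≤ ℓ Q) (hlM : ∀ Q ∈ T, ℓ Q ≤ M)
    (hlam : 0 < lam) (hu : 0 < u) (hu' : 0 < u') (hμ : lam * M ≤ μ * u') (hμ1 : μ ≤ 1)
    (hsum : a * X * h ≤ ∑ Q ∈ T, ℓ Q) (hstep : 1 - (1 - μ) * a ≤ u' / u) :
    ∑ Q ∈ T, Real.exp (lam * ((X - ℓ Q) / u' - 1)) ≤ h * Real.exp (lam * (X / u - 1)) := by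
  have hh : 0 ≤ h := le_trans (by positivity) hT
  set E := Real.exp (lam * (X / u' - 1)) with hE
  have hE0 : 0 < E := Real.exp_pos _
  have hterm : ∀ Q ∈ T, Real.exp (lam * ((X - ℓ Q) / u' - 1))
      ≤ E * (1 - (1 - μ) * (lam / u') * ℓ Q) := by
    intro Q hQ
    set y := lam / u' * ℓ Q with hy
    have hy0 : 0 ≤ y := by have := hl0 Q hQ; positivity
    have hyμ : y ≤ μ := by
      have h1 : y = lam * ℓ Q / u' := by rw [hy]; ring
      rw [h1, div_le_iff₀ hu']
      exact le_trans (mul_le_mul_of_nonneg_left (hlM Q hQ) hlam.le) hμ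
    have h2 := (abs_le.1 (Real.abs_exp_sub_one_sub_id_le (x := -y)
      (by rw [abs_neg, abs_of_nonneg hy0]; linarith))).2
    have h3 : lam * ((X - ℓ Q) / u' - 1) = lam * (X / u' - 1) + -y := by
      rw [hy]; ring
    rw [h3, Real.exp_add]
    refine mul_le_mul_of_nonneg_left ?_ hE0.le
    have h4 : (1 - μ) * (lam / u') * ℓ Q = (1 - μ) * y := by rw [hy]; ring
    rw [h4]
    nlinarith
  refine (Finset.sum_le_sum hterm).trans ?_
  rw [← Finset.mul_sum, Finset.sum_sub_distrib, ← Finset.mul_sum]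
  simp only [sum_const, nsmul_eq_mul, mul_one]
  set z := (1 - μ) * (lam / u') * (a * X) with hz
  have h5 : (#T : ℝ) - (1 - μ) * (lam / u') * ∑ Q ∈ T, ℓ Q ≤ h * (1 - z) := by
    have h6 : 0 ≤ (1 - μ) * (lam / u') := mul_nonneg (by linarith) (by positivity)
    have h7 := mul_le_mul_of_nonneg_left hsum h6
    have h8 : h * (1 - z) = h - (1 - μ) * (lam / u') * (a * X * h) := by rw [hz]; ring
    linarith
  have h9 : 1 - z ≤ Real.exp (-z) := by have := Real.add_one_le_exp (-z); linarith
  calc E * ((#T : ℝ) - (1 - μ) * (lam / u') * ∑ Q ∈ T, ℓ Q) ≤ E * (h * Real.exp (-z)) :=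
        mul_le_mul_of_nonneg_left (h5.trans (mul_le_mul_of_nonneg_left h9 hh)) hE0.le
    _ = h * Real.exp (lam * (X / u' - 1) + -z) := by rw [Real.exp_add]; ring
    _ ≤ h * Real.exp (lam * (X / u - 1)) := by
        refine mul_le_mul_of_nonneg_left (Real.exp_le_exp.2 ?_) hh
        have h10 : lam * (X / u' - 1) + -z = lam * X / u' * (1 - (1 - μ) * a) - lam := by
          rw [hz]; ring
        have h11 : lam * (X / u - 1) = lam * X / u' * (u' / u) - lam := by
          field_simp
        rw [h10, h11]
        have : 0 ≤ lam * X / u' := by positivity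
        linarith [mul_le_mul_of_nonneg_left hstep this]

/-- The lower-tail counterpart of `sum_exp_upper_step`. -/
theorem sum_exp_lower_step {β : Type*} (T : Finset β) (h : ℝ) (hT : (#T : ℝ) ≤ h) (ℓ : β → ℝ)
    {X M b μ lam u u' : ℝ} (hX : 0 ≤ X) (hl0 : ∀ Q ∈ T, 0 ≤ ℓ Q) (hlM : ∀ Q ∈ T, ℓ Q ≤ M)
    (hlam : 0 < lam) (hu : 0 < u) (hu' : 0 < u') (hμ : lam * M ≤ μ * u') (hμ0 : 0 ≤ μ)
    (hμ1 : μ ≤ 1)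
    (hsum : ∑ Q ∈ T, ℓ Q ≤ b * X * h) (hstep : u' / u ≤ 1 - (1 + μ) * b) :
    ∑ Q ∈ T, Real.exp (lam * (1 - (X - ℓ Q) / u')) ≤ h * Real.exp (lam * (1 - X / u)) := by
  have hh : 0 ≤ h := le_trans (by positivity) hT
  set E := Real.exp (lam * (1 - X / u')) with hE
  have hE0 : 0 < E := Real.exp_pos _
  have hterm : ∀ Q ∈ T, Real.exp (lam * (1 - (X - ℓ Q) / u'))
      ≤ E * (1 + (1 + μ) * (lam / u') * ℓ Q) := by
    intro Q hQ
    set y := lam / u' * ℓ Q with hy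
    have hy0 : 0 ≤ y := by have := hl0 Q hQ; positivity
    have hyμ : y ≤ μ := by
      have h1 : y = lam * ℓ Q / u' := by rw [hy]; ring
      rw [h1, div_le_iff₀ hu']
      exact le_trans (mul_le_mul_of_nonneg_left (hlM Q hQ) hlam.le) hμ
    have h2 := (abs_le.1 (Real.abs_exp_sub_one_sub_id_le (x := y)
      (by rw [abs_of_nonneg hy0]; linarith))).2
    have h3 : lam * (1 - (X - ℓ Q) / u') = lam * (1 - X / u') + y := by
      rw [hy]; ring
    rw [h3, Real.exp_add]
    refine mul_le_mul_of_nonneg_left ?_ hE0.le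
    have h4 : (1 + μ) * (lam / u') * ℓ Q = (1 + μ) * y := by rw [hy]; ring
    rw [h4]
    nlinarith
  refine (Finset.sum_le_sum hterm).trans ?_
  rw [← Finset.mul_sum, Finset.sum_add_distrib, ← Finset.mul_sum]
  simp only [sum_const, nsmul_eq_mul, mul_one]
  set z := (1 + μ) * (lam / u') * (b * X) with hz
  have h5 : (#T : ℝ) + (1 + μ) * (lam / u') * ∑ Q ∈ T, ℓ Q ≤ h * (1 + z) := by
    have h6 : 0 ≤ (1 + μ) * (lam / u') := mul_nonneg (by linarith) (by positivity)
    have h7 := mul_le_mul_of_nonneg_left hsum h6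
    have h8 : h * (1 + z) = h + (1 + μ) * (lam / u') * (b * X * h) := by rw [hz]; ring
    linarith
  have h9 : 1 + z ≤ Real.exp z := by have := Real.add_one_le_exp z; linarith
  calc E * ((#T : ℝ) + (1 + μ) * (lam / u') * ∑ Q ∈ T, ℓ Q) ≤ E * (h * Real.exp z) :=
        mul_le_mul_of_nonneg_left (h5.trans (mul_le_mul_of_nonneg_left h9 hh)) hE0.le
    _ = h * Real.exp (lam * (1 - X / u') + z) := by rw [Real.exp_add]; ring
    _ ≤ h * Real.exp (lam * (1 - X / u)) := by
        refine mul_le_mul_of_nonneg_left (Real.exp_le_exp.2 ?_) hh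
        have h10 : lam * (1 - X / u') + z = lam - lam * X / u' * (1 - (1 + μ) * b) := by
          rw [hz]; ring
        have h11 : lam * (1 - X / u) = lam - lam * X / u' * (u' / u) := by
          field_simp
        rw [h10, h11]
        have : 0 ≤ lam * X / u' := by positivity
        linarith [mul_le_mul_of_nonneg_left hstep this]

section Hypergraph

variable {α β : Type*} [DecidableEq α]

/-- The degree of the vertex `v` in the hypergraph with edges `c Q`, `Q ∈ H`. -/
def hdeg (H : Finset β) (c : β → Finset α) (v : α) : ℕ := #{Q ∈ H | v ∈ c Q}

/-- The codegree of the vertices `u` and `v`. -/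
def hcodeg (H : Finset β) (c : β → Finset α) (u v : α) : ℕ := #{Q ∈ H | u ∈ c Q ∧ v ∈ c Q}

/-- The edges disjoint from the edge `Q`. -/
def hres (H : Finset β) (c : β → Finset α) (Q : β) : Finset β := {Q' ∈ H | Disjoint (c Q') (c Q)}

/-- The number of edges at `v` that meet the edge `Q`. -/
def hloss (H : Finset β) (c : β → Finset α) (v : α) (Q : β) : ℕ :=
  #{Q' ∈ H | v ∈ c Q' ∧ ¬ Disjoint (c Q') (c Q)}

theorem hdeg_hres_add_hloss (H : Finset β) (c : β → Finset α) (v : α) (Q : β) :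
    hdeg (hres H c Q) c v + hloss H c v Q = hdeg H c v := by
  unfold hdeg hres hloss
  rw [← Finset.card_filter_add_card_filter_not (s := {Q' ∈ H | v ∈ c Q'})
    (fun Q' => Disjoint (c Q') (c Q))]
  simp only [Finset.filter_filter, and_comm]

theorem hloss_le (H : Finset β) (c : β → Finset α) {v : α} {Q : β} {C k : ℕ}
    (hk : #(c Q) = k) (hvQ : v ∉ c Q) (hC : ∀ u v, u ≠ v → hcodeg H c u v ≤ C) :
    hloss H c v Q ≤ k * C := by
  classical
  have hsub : ({Q' ∈ H | v ∈ c Q' ∧ ¬ Disjoint (c Q') (c Q)} : Finset β) ⊆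
      (c Q).biUnion (fun u => {Q' ∈ H | u ∈ c Q' ∧ v ∈ c Q'}) := by
    intro Q' hQ'
    simp only [mem_filter, Finset.not_disjoint_iff, mem_biUnion] at hQ' ⊢
    obtain ⟨h1, h2, u, hu1, hu2⟩ := hQ'
    exact ⟨u, hu2, h1, hu1, h2⟩
  refine (Finset.card_le_card hsub).trans ?_
  rw [← hk]
  refine Finset.card_biUnion_le_card_mul _ _ _ fun u hu => hC u v ?_
  rintro rfl; exact hvQ hu

theorem sum_hdeg (H : Finset β) (c : β → Finset α) (S : Finset α) :
    ∑ v ∈ S, hdeg H c v = ∑ Q ∈ H, #(S ∩ c Q) := by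
  unfold hdeg
  simp only [Finset.card_filter]
  rw [Finset.sum_comm]
  refine Finset.sum_congr rfl fun Q _ => ?_
  rw [← Finset.card_filter, Finset.filter_mem_eq_inter]

/-- The number of edges of `H` avoiding `v` and meeting the edge `Q'`. -/
def hmeet (H : Finset β) (c : β → Finset α) (v : α) (Q' : β) : ℕ :=
  #{Q ∈ H | v ∉ c Q ∧ ¬ Disjoint (c Q') (c Q)}

theorem sum_hloss (H : Finset β) (c : β → Finset α) (v : α) :
    ∑ Q ∈ H with v ∉ c Q, hloss H c v Q = ∑ Q' ∈ H with v ∈ c Q', hmeet H c v Q' := by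
  unfold hloss hmeet
  simp only [Finset.card_filter, Finset.sum_filter]
  rw [Finset.sum_congr rfl (g := fun Q => ∑ Q' ∈ H, if v ∉ c Q ∧ v ∈ c Q' ∧
    ¬ Disjoint (c Q') (c Q) then 1 else 0), Finset.sum_comm]
  · refine Finset.sum_congr rfl fun Q' _ => ?_
    by_cases h : v ∈ c Q' <;> simp [h]
  · intro Q _
    by_cases h : v ∈ c Q <;> simp [h]

theorem hmeet_le (H : Finset β) (c : β → Finset α) {v : α} {Q' : β} :
    hmeet H c v Q' ≤ ∑ u ∈ (c Q').erase v, hdeg H c u := by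
  classical
  unfold hmeet hdeg
  refine le_trans (Finset.card_le_card ?_) Finset.card_biUnion_le
  intro Q hQ
  simp only [mem_filter, Finset.not_disjoint_iff, mem_biUnion, mem_erase] at hQ ⊢
  obtain ⟨h1, h2, u, hu1, hu2⟩ := hQ
  exact ⟨u, ⟨fun h => h2 (h ▸ hu2), hu1⟩, h1, hu2⟩

theorem sum_hdeg_le_hmeet_add (H : Finset β) (c : β → Finset α) {v : α} {Q' : β}
    (hv : v ∈ c Q') :
    ∑ u ∈ (c Q').erase v, hdeg H c u ≤
      hmeet H c v Q' + ∑ x ∈ (c Q').offDiag, hcodeg H c x.1 x.2 := by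
  have h1 : ∑ x ∈ (c Q').offDiag, hcodeg H c x.1 x.2 = ∑ Q ∈ H, #(c Q' ∩ c Q).offDiag := by
    unfold hcodeg
    simp only [Finset.card_filter]
    rw [Finset.sum_comm]
    refine Finset.sum_congr rfl fun Q _ => ?_
    rw [← Finset.card_filter]
    congr 1
    ext x
    simp only [mem_filter, mem_offDiag, mem_inter]
    tauto
  rw [h1, sum_hdeg, hmeet, Finset.card_filter, ← Finset.sum_add_distrib]
  refine Finset.sum_le_sum fun Q _ => ?_
  rw [Finset.offDiag_card, Finset.erase_inter]
  by_cases hvQ : v ∈ c Q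
  · rw [Finset.card_erase_of_mem (mem_inter.2 ⟨hv, hvQ⟩)]
    simp only [hvQ, not_true_eq_false, false_and, if_false, zero_add]
    have hpos : 0 < #(c Q' ∩ c Q) := Finset.card_pos.2 ⟨v, mem_inter.2 ⟨hv, hvQ⟩⟩
    obtain ⟨t, ht⟩ := Nat.exists_eq_succ_of_ne_zero hpos.ne'
    rw [ht]
    have : t.succ * t.succ - t.succ = t.succ * t := by
      rw [Nat.mul_succ]; simp
    rw [this]
    simp only [Nat.succ_eq_add_one, Nat.add_sub_cancel]
    nlinarith
  · rw [Finset.erase_eq_of_notMem (fun h => hvQ (mem_inter.1 h).2)]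
    rcases Nat.eq_zero_or_pos (#(c Q' ∩ c Q)) with h0 | hpos
    · simp [h0]
    · have hnd : ¬ Disjoint (c Q') (c Q) := by
        rw [Finset.disjoint_iff_inter_eq_empty, ← Finset.card_eq_zero]; omega
      simp only [hvQ, hnd, not_false_eq_true, and_self, if_true]
      obtain ⟨t, ht⟩ := Nat.exists_eq_succ_of_ne_zero hpos.ne'
      rw [ht]
      have : t.succ * t.succ - t.succ = t.succ * t := by
        rw [Nat.mul_succ]; simp
      rw [this]
      simp only [Nat.succ_eq_add_one]
      nlinarith

/-- The potential of a state: it is at least `1` as soon as some degree leaves `(L, U)` or some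
tracked set has at least `W` vertices left in `V`. -/
noncomputable def hpot {ι : Type*} (V : Finset α) (H : Finset β) (c : β → Finset α) (F : Finset ι)
    (S : ι → Finset α) (lam U L W : ℝ) : ℝ :=
  (∑ v ∈ V, Real.exp (lam * ((hdeg H c v : ℝ) / U - 1)) +
    ∑ v ∈ V, Real.exp (lam * (1 - (hdeg H c v : ℝ) / L))) +
    ∑ f ∈ F, Real.exp (lam * ((#(V ∩ S f) : ℝ) / W - 1))

theorem sum_sum_sdiff (V : Finset α) (H : Finset β) (c : β → Finset α) (g : β → α → ℝ) :
    ∑ Q ∈ H, ∑ v ∈ V \ c Q, g Q v = ∑ v ∈ V, ∑ Q ∈ H with v ∉ c Q, g Q v := by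
  refine Finset.sum_comm' ?_
  intro Q v
  simp only [mem_sdiff, mem_filter]
  tauto

/-- One greedy step: some edge can be chosen so that the potential does not increase. -/
theorem exists_hpot_le {ι : Type*} (V : Finset α) (H : Finset β) (c : β → Finset α)
    (F : Finset ι) (S : ι → Finset α) {k C : ℕ} {lam μ s U L W U' L' W' : ℝ}
    (hk1 : 1 ≤ k) (hVne : V.Nonempty)
    (hcV : ∀ Q ∈ H, c Q ⊆ V) (hck : ∀ Q ∈ H, #(c Q) = k)
    (hC : ∀ u v, u ≠ v → hcodeg H c u v ≤ C)
    (hdU : ∀ v ∈ V, (hdeg H c v : ℝ) ≤ U) (hdL : ∀ v ∈ V, L ≤ (hdeg H c v : ℝ))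
    (hs : s * #V = k)
    (hlam : 0 < lam) (hL : 0 < L) (hW : 0 < W) (hU' : 0 < U') (hL' : 0 < L')
    (hW' : 0 < W') (hμ0 : 0 ≤ μ) (hμ1 : μ ≤ 1)
    (hμU : lam * (k * C) ≤ μ * U') (hμL : lam * (k * C) ≤ μ * L') (hμW : lam * k ≤ μ * W')
    (hpos : 0 ≤ (k - 1) * L - k ^ 2 * C)
    (hstepU : 1 - (1 - μ) * (s * ((k - 1) * L - k ^ 2 * C) / U) ≤ U' / U)
    (hstepL : L' / L ≤ 1 - (1 + μ) * (s * ((k - 1) * U) / L))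
    (hstepW : 1 - (1 - μ) * (s * L / U) ≤ W' / W) :
    ∃ Q ∈ H, hpot (V \ c Q) (hres H c Q) c F S lam U' L' W' ≤ hpot V H c F S lam U L W := by
  have hV0 : (0 : ℝ) < #V := by exact_mod_cast Finset.card_pos.2 hVne
  have hk0 : (0 : ℝ) < k := by exact_mod_cast hk1
  have hs0 : 0 < s := by
    by_contra h
    have := mul_nonneg (neg_nonneg.2 (not_lt.1 h)) hV0.le
    linarith
  have hLU : L ≤ U := by
    obtain ⟨v, hv⟩ := hVne
    exact (hdL v hv).trans (hdU v hv)
  have hU : 0 < U := hL.trans_le hLU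
  -- the number of edges
  have hsumk : ∑ v ∈ V, (hdeg H c v : ℝ) = k * #H := by
    have h1 := sum_hdeg H c V
    have h2 : ∑ Q ∈ H, #(V ∩ c Q) = #H * k := by
      rw [Finset.sum_congr rfl (g := fun _ => k)]
      · simp
      · intro Q hQ
        rw [Finset.inter_eq_right.2 (hcV Q hQ), hck Q hQ]
    rw [h2] at h1
    rw [mul_comm]
    exact_mod_cast h1
  have hHU : s * #H ≤ U := by
    have h1 : ∑ v ∈ V, (hdeg H c v : ℝ) ≤ #V * U := by
      simpa using Finset.sum_le_sum hdU
    rw [hsumk, ← hs] at h1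
    have : #V * (s * #H) ≤ #V * U := by linarith
    exact le_of_mul_le_mul_left this hV0
  have hHL : L ≤ s * #H := by
    have h1 : #V * L ≤ ∑ v ∈ V, (hdeg H c v : ℝ) := by
      simpa using Finset.sum_le_sum hdL
    rw [hsumk, ← hs] at h1
    have : #V * L ≤ #V * (s * #H) := by linarith
    exact le_of_mul_le_mul_left this hV0
  have hHpos : (0 : ℝ) < #H := by
    by_contra h
    have := mul_nonneg hs0.le (neg_nonneg.2 (not_lt.1 h))
    linarith
  have hHne : H.Nonempty := Finset.card_pos.1 (by exact_mod_cast hHpos)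
  -- degree losses
  have hres_deg : ∀ v Q, (hdeg (hres H c Q) c v : ℝ) = hdeg H c v - hloss H c v Q := by
    intro v Q
    rw [← hdeg_hres_add_hloss H c v Q]; push_cast; ring
  have hloss_M : ∀ v, ∀ Q ∈ ({Q ∈ H | v ∉ c Q} : Finset β), (hloss H c v Q : ℝ) ≤ k * C := by
    intro v Q hQ
    rw [mem_filter] at hQ
    exact_mod_cast hloss_le H c (hck Q hQ.1) hQ.2 hC
  have hTcard : ∀ v, (#({Q ∈ H | v ∉ c Q} : Finset β) : ℝ) ≤ #H := by
    intro v
    exact_mod_cast Finset.card_filter_le _ _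
  have herase : ∀ v, ∀ Q' ∈ ({Q ∈ H | v ∈ c Q} : Finset β), (#((c Q').erase v) : ℝ) = k - 1 := by
    intro v Q' hQ'
    rw [mem_filter] at hQ'
    rw [Finset.card_erase_of_mem hQ'.2, hck Q' hQ'.1]
    push_cast [hk1]; rfl
  have hlow : ∀ v ∈ V, ((k - 1) * L - k ^ 2 * C) * hdeg H c v ≤
      ∑ Q ∈ H with v ∉ c Q, (hloss H c v Q : ℝ) := by
    intro v hv
    have h1 : ∑ Q ∈ H with v ∉ c Q, (hloss H c v Q : ℝ)
        = ∑ Q' ∈ H with v ∈ c Q', (hmeet H c v Q' : ℝ) := by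
      exact_mod_cast sum_hloss H c v
    rw [h1]
    have h2 : ((k - 1) * L - k ^ 2 * C) * hdeg H c v
        = ∑ Q' ∈ H with v ∈ c Q', ((k - 1) * L - k ^ 2 * C) := by
      rw [Finset.sum_const, nsmul_eq_mul, mul_comm]; rfl
    rw [h2]
    refine Finset.sum_le_sum fun Q' hQ' => ?_
    have h3 := herase v Q' hQ'
    rw [mem_filter] at hQ'
    have h4 : (∑ u ∈ (c Q').erase v, (hdeg H c u : ℝ)) ≤ hmeet H c v Q' +
        ∑ x ∈ (c Q').offDiag, (hcodeg H c x.1 x.2 : ℝ) := by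
      exact_mod_cast sum_hdeg_le_hmeet_add H c hQ'.2
    have h5 : (k - 1) * L ≤ ∑ u ∈ (c Q').erase v, (hdeg H c u : ℝ) := by
      rw [← h3]
      simpa using Finset.sum_le_sum fun u (hu : u ∈ (c Q').erase v) =>
        hdL u (hcV Q' hQ'.1 (Finset.mem_of_mem_erase hu))
    have h6 : ∑ x ∈ (c Q').offDiag, (hcodeg H c x.1 x.2 : ℝ) ≤ k ^ 2 * C := by
      have h7 : ∑ x ∈ (c Q').offDiag, hcodeg H c x.1 x.2 ≤ #(c Q').offDiag * C := by
        refine (Finset.sum_le_card_nsmul _ _ C fun x hx => ?_).trans (by simp)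
        exact hC _ _ (mem_offDiag.1 hx).2.2
      have h8 : #(c Q').offDiag * C ≤ k ^ 2 * C := by
        refine Nat.mul_le_mul_right _ ?_
        rw [offDiag_card, hck Q' hQ'.1, sq]
        exact Nat.sub_le _ _
      exact_mod_cast h7.trans h8
    linarith
  have hupp : ∀ v ∈ V, ∑ Q ∈ H with v ∉ c Q, (hloss H c v Q : ℝ) ≤
      ((k - 1) * U) * hdeg H c v := by
    intro v hv
    have h1 : ∑ Q ∈ H with v ∉ c Q, (hloss H c v Q : ℝ)
        = ∑ Q' ∈ H with v ∈ c Q', (hmeet H c v Q' : ℝ) := by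
      exact_mod_cast sum_hloss H c v
    rw [h1]
    have h2 : ((k - 1) * U) * hdeg H c v
        = ∑ Q' ∈ H with v ∈ c Q', ((k - 1) * U) := by
      rw [Finset.sum_const, nsmul_eq_mul, mul_comm]; rfl
    rw [h2]
    refine Finset.sum_le_sum fun Q' hQ' => ?_
    have h3 := herase v Q' hQ'
    rw [mem_filter] at hQ'
    have h4 : (hmeet H c v Q' : ℝ) ≤ ∑ u ∈ (c Q').erase v, (hdeg H c u : ℝ) := by
      exact_mod_cast hmeet_le H c
    refine h4.trans ?_
    rw [← h3]
    simpa using Finset.sum_le_sum fun u (hu : u ∈ (c Q').erase v) =>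
      hdU u (hcV Q' hQ'.1 (Finset.mem_of_mem_erase hu))
  -- the three families of exponential moments
  have hpartU : ∑ Q ∈ H, ∑ v ∈ V \ c Q, Real.exp (lam * ((hdeg (hres H c Q) c v : ℝ) / U' - 1))
      ≤ #H * ∑ v ∈ V, Real.exp (lam * ((hdeg H c v : ℝ) / U - 1)) := by
    rw [sum_sum_sdiff, Finset.mul_sum]
    refine Finset.sum_le_sum fun v hv => ?_
    simp only [hres_deg]
    refine sum_exp_upper_step _ _ (hTcard v) (fun Q => (hloss H c v Q : ℝ)) (by positivity)
      (fun Q _ => by positivity) (hloss_M v) hlam hU hU' hμU hμ1 ?_ hstepU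
    refine le_trans ?_ (hlow v hv)
    have h1 : s * ((k - 1) * L - k ^ 2 * C) / U * (hdeg H c v) * #H
        = ((k - 1) * L - k ^ 2 * C) * hdeg H c v * (s * #H / U) := by ring
    rw [h1]
    exact mul_le_of_le_one_right (mul_nonneg hpos (by positivity)) ((div_le_one hU).2 hHU)
  have hpartL : ∑ Q ∈ H, ∑ v ∈ V \ c Q, Real.exp (lam * (1 - (hdeg (hres H c Q) c v : ℝ) / L'))
      ≤ #H * ∑ v ∈ V, Real.exp (lam * (1 - (hdeg H c v : ℝ) / L)) := by
    rw [sum_sum_sdiff, Finset.mul_sum]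
    refine Finset.sum_le_sum fun v hv => ?_
    simp only [hres_deg]
    refine sum_exp_lower_step _ _ (hTcard v) (fun Q => (hloss H c v Q : ℝ)) (by positivity)
      (fun Q _ => by positivity) (hloss_M v) hlam hL hL' hμL hμ0 hμ1 ?_ hstepL
    refine (hupp v hv).trans ?_
    have h1 : s * ((k - 1) * U) / L * (hdeg H c v) * #H
        = ((k - 1) * U) * hdeg H c v * (s * #H / L) := by ring
    rw [h1]
    have hk1' : (0 : ℝ) ≤ k - 1 := by
      have : (1 : ℝ) ≤ k := by exact_mod_cast hk1
      linarith
    exact le_mul_of_one_le_right (by positivity) ((one_le_div hL).2 hHL)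
  have hpartW : ∑ Q ∈ H, ∑ f ∈ F, Real.exp (lam * ((#((V \ c Q) ∩ S f) : ℝ) / W' - 1))
      ≤ #H * ∑ f ∈ F, Real.exp (lam * ((#(V ∩ S f) : ℝ) / W - 1)) := by
    rw [Finset.sum_comm, Finset.mul_sum]
    refine Finset.sum_le_sum fun f _ => ?_
    have hcard : ∀ Q, (#((V \ c Q) ∩ S f) : ℝ) = #(V ∩ S f) - #((V ∩ S f) ∩ c Q) := by
      intro Q
      have h1 := Finset.card_sdiff_add_card_inter (V ∩ S f) (c Q)
      have h2 : (V \ c Q) ∩ S f = (V ∩ S f) \ c Q := by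
        ext x; simp only [mem_inter, mem_sdiff]; tauto
      rw [h2, ← h1]; push_cast; ring
    simp only [hcard]
    refine sum_exp_upper_step _ _ le_rfl (fun Q => (#((V ∩ S f) ∩ c Q) : ℝ)) (by positivity)
      (fun Q _ => by positivity) (M := k) (fun Q hQ => ?_) hlam hW hW' hμW hμ1 ?_ hstepW
    · rw [← hck Q hQ]
      exact_mod_cast Finset.card_le_card Finset.inter_subset_right
    · have h1 : ∑ Q ∈ H, (#((V ∩ S f) ∩ c Q) : ℝ) = ∑ v ∈ V ∩ S f, (hdeg H c v : ℝ) := by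
        exact_mod_cast (sum_hdeg H c (V ∩ S f)).symm
      rw [h1]
      have h2 : #(V ∩ S f) * L ≤ ∑ v ∈ V ∩ S f, (hdeg H c v : ℝ) := by
        simpa using Finset.sum_le_sum fun v (hv : v ∈ V ∩ S f) => hdL v (mem_inter.1 hv).1
      refine le_trans ?_ h2
      have h3 : s * L / U * #(V ∩ S f) * #H = #(V ∩ S f) * L * (s * #H / U) := by ring
      rw [h3]
      exact mul_le_of_le_one_right (by positivity) ((div_le_one hU).2 hHU)
  refine Finset.exists_le_of_sum_le hHne ?_
  simp only [hpot, Finset.sum_add_distrib, Finset.sum_const, nsmul_eq_mul]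
  linarith

theorem lt_of_hpot_lt_one {ι : Type*} {V : Finset α} {H : Finset β} {c : β → Finset α}
    {F : Finset ι} {S : ι → Finset α} {lam U L W : ℝ} (hlam : 0 < lam) (hU : 0 < U) (hL : 0 < L)
    (hW : 0 < W) (h : hpot V H c F S lam U L W < 1) :
    (∀ v ∈ V, L < hdeg H c v ∧ (hdeg H c v : ℝ) < U) ∧ ∀ f ∈ F, (#(V ∩ S f) : ℝ) < W := by
  have key : ∀ x : ℝ, Real.exp (lam * x) < 1 → x < 0 := by
    intro x hx
    rw [Real.exp_lt_one_iff] at hx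
    by_contra h0
    exact absurd (mul_nonneg hlam.le (not_lt.1 h0)) (not_le.2 hx)
  unfold hpot at h
  have hA : 0 ≤ ∑ v ∈ V, Real.exp (lam * ((hdeg H c v : ℝ) / U - 1)) :=
    Finset.sum_nonneg fun _ _ => (Real.exp_pos _).le
  have hB : 0 ≤ ∑ v ∈ V, Real.exp (lam * (1 - (hdeg H c v : ℝ) / L)) :=
    Finset.sum_nonneg fun _ _ => (Real.exp_pos _).le
  have hD : 0 ≤ ∑ f ∈ F, Real.exp (lam * ((#(V ∩ S f) : ℝ) / W - 1)) :=
    Finset.sum_nonneg fun _ _ => (Real.exp_pos _).le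
  refine ⟨fun v hv => ⟨?_, ?_⟩, fun f hf => ?_⟩
  · have h1 := Finset.single_le_sum
      (f := fun v => Real.exp (lam * (1 - (hdeg H c v : ℝ) / L)))
      (fun _ _ => (Real.exp_pos _).le) hv
    have h2 := key (1 - (hdeg H c v : ℝ) / L) (by linarith)
    exact (one_lt_div hL).1 (by linarith)
  · have h1 := Finset.single_le_sum
      (f := fun v => Real.exp (lam * ((hdeg H c v : ℝ) / U - 1)))
      (fun _ _ => (Real.exp_pos _).le) hv
    have h2 := key ((hdeg H c v : ℝ) / U - 1) (by linarith)
    exact (div_lt_one hU).1 (by linarith)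
  · have h1 := Finset.single_le_sum
      (f := fun f => Real.exp (lam * ((#(V ∩ S f) : ℝ) / W - 1)))
      (fun _ _ => (Real.exp_pos _).le) hf
    have h2 := key ((#(V ∩ S f) : ℝ) / W - 1) (by linarith)
    exact (div_lt_one hW).1 (by linarith)

end Hypergraph

/-- The relative error allowed when a proportion `p` of the vertices is left. -/
noncomputable def relErr (δ : ℝ) (k : ℕ) (p : ℝ) : ℝ := δ / p ^ (2 * k)

theorem relErr_step {δ p s : ℝ} (k : ℕ) (hδ : 0 ≤ δ) (hp : 0 < p) (hs0 : 0 ≤ s) (hs1 : s < 1) :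
    relErr δ k p * (1 + 2 * k * s) ≤ relErr δ k (p * (1 - s)) := by
  unfold relErr
  have h1 : 0 < (1 - s) ^ (2 * k) := pow_pos (by linarith) _
  have h2 : 0 < p ^ (2 * k) := pow_pos hp _
  have h3 : 1 + 2 * k * s ≤ (1 + s) ^ (2 * k) := by
    have := one_add_mul_le_pow (show (-2 : ℝ) ≤ s by linarith) (2 * k)
    push_cast at this
    exact this
  have h4 : (1 + 2 * k * s) * (1 - s) ^ (2 * k) ≤ 1 := by
    calc (1 + 2 * k * s) * (1 - s) ^ (2 * k) ≤ (1 + s) ^ (2 * k) * (1 - s) ^ (2 * k) :=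
          mul_le_mul_of_nonneg_right h3 h1.le
      _ = ((1 + s) * (1 - s)) ^ (2 * k) := (mul_pow _ _ _).symm
      _ ≤ 1 := pow_le_one₀ (mul_nonneg (by linarith) (by linarith)) (by nlinarith)
  rw [mul_pow, div_mul_eq_mul_div, div_le_div_iff₀ h2 (by positivity)]
  have h5 := mul_le_mul_of_nonneg_left h4 (show 0 ≤ δ * p ^ (2 * k) by positivity)
  linarith

theorem one_sub_pow_le {s : ℝ} (m : ℕ) (hs0 : 0 ≤ s) (hs1 : s ≤ 1) :
    (1 - s) ^ m ≤ 1 - m * s + (m * s) ^ 2 := by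
  have h1 := one_add_mul_le_pow (show (-2 : ℝ) ≤ s by linarith) m
  have h2 : 0 ≤ (1 - s) ^ m := pow_nonneg (by linarith) _
  have h3 : (1 + m * s) * (1 - s) ^ m ≤ 1 := by
    calc (1 + m * s) * (1 - s) ^ m ≤ (1 + s) ^ m * (1 - s) ^ m :=
          mul_le_mul_of_nonneg_right h1 h2
      _ = ((1 + s) * (1 - s)) ^ m := (mul_pow _ _ _).symm
      _ ≤ 1 := pow_le_one₀ (mul_nonneg (by linarith) (by linarith)) (by nlinarith)
  have h4 : (0 : ℝ) ≤ m * s := by positivity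
  set x := (m : ℝ) * s
  have h5 : (1 - s) ^ m ≤ 1 / (1 + x) := by rw [le_div_iff₀ (by linarith)]; linarith
  refine h5.trans ?_
  rw [div_le_iff₀ (by linarith)]
  nlinarith [pow_nonneg h4 3]

/-- The upper envelope of the degrees dominates the drift of a degree. -/
theorem upper_envelope_step {K s δ δ' μ C B B' P : ℝ} (hK : 2 ≤ K) (hs0 : 0 ≤ s) (hδ0 : 0 < δ)
    (hδ1 : δ ≤ 1 / 2) (hB : 0 < B) (hC0 : 0 ≤ C) (hμ0 : 0 ≤ μ) (hμ : K * μ ≤ δ / 8)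
    (hs : K ^ 2 * s ≤ δ / 8) (hC : K ^ 2 * C ≤ δ / 8 * B) (hB' : B' = B * P)
    (hP : 1 - (K - 1) * s ≤ P) (hδ' : δ * (1 + 2 * K * s) ≤ δ') :
    1 - (1 - μ) * (s * ((K - 1) * (B * (1 - δ)) - K ^ 2 * C) / (B * (1 + δ)))
      ≤ B' * (1 + δ') / (B * (1 + δ)) := by
  set g := K ^ 2 * C / B with hg
  have hg0 : 0 ≤ g := by positivity
  have hg1 : g ≤ δ / 8 := by rw [hg, div_le_iff₀ hB]; exact hC
  have hCg : K ^ 2 * C = g * B := by rw [hg]; field_simp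
  have hKs : (K - 1) * s ≤ 1 := by nlinarith
  have hPl : (1 - (K - 1) * s) * (1 + δ * (1 + 2 * K * s)) ≤ P * (1 + δ') :=
    mul_le_mul hP (by linarith) (by have : 0 ≤ K * s := by positivity
                                    nlinarith) (by linarith)
  have key : (1 + δ) - (1 - μ) * (s * ((K - 1) * (1 - δ) - g)) ≤ P * (1 + δ') := by
    refine le_trans ?_ hPl
    have e : (1 - (K - 1) * s) * (1 + δ * (1 + 2 * K * s)) -
      ((1 + δ) - (1 - μ) * (s * ((K - 1) * (1 - δ) - g))) =
      s * (2 * δ - 2 * K * (K - 1) * s * δ - g - μ * ((K - 1) * (1 - δ)) + μ * g) := by ring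
    have h1 : 2 * K * (K - 1) * s * δ ≤ δ / 4 := by
      have h2 : K * (K - 1) * s ≤ K ^ 2 * s := mul_le_mul_of_nonneg_right (by nlinarith) hs0
      have h3 : K * (K - 1) * s ≤ 1 / 8 := by linarith
      nlinarith
    have h4 : μ * ((K - 1) * (1 - δ)) ≤ δ / 8 := by
      have : (K - 1) * (1 - δ) ≤ K := by nlinarith
      nlinarith
    have h5 : 0 ≤ μ * g := mul_nonneg hμ0 hg0
    have := mul_nonneg hs0 (show 0 ≤ 2 * δ - 2 * K * (K - 1) * s * δ - g -
      μ * ((K - 1) * (1 - δ)) + μ * g by linarith)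
    linarith
  have hδp : 0 < 1 + δ := by linarith
  rw [hCg, hB']
  have e1 : s * ((K - 1) * (B * (1 - δ)) - g * B) / (B * (1 + δ))
      = s * ((K - 1) * (1 - δ) - g) / (1 + δ) := by field_simp
  have e2 : B * P * (1 + δ') / (B * (1 + δ)) = P * (1 + δ') / (1 + δ) := by field_simp
  rw [e1, e2, le_div_iff₀ hδp]
  have e3 : (1 - (1 - μ) * (s * ((K - 1) * (1 - δ) - g) / (1 + δ))) * (1 + δ)
      = (1 + δ) - (1 - μ) * (s * ((K - 1) * (1 - δ) - g)) := by field_simp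
  rw [e3]; exact key

/-- The lower envelope of the degrees is dominated by the drift of a degree. -/
theorem lower_envelope_step {K s δ δ' μ B B' P : ℝ} (hK : 2 ≤ K) (hs0 : 0 ≤ s) (hδ0 : 0 < δ)
    (hδ1 : δ ≤ 1 / 2) (hB : 0 < B) (hμ0 : 0 ≤ μ) (hμ : K * μ ≤ δ / 8)
    (hs : K ^ 2 * s ≤ δ / 8) (hB' : B' = B * P) (hP0 : 0 ≤ P)
    (hP : P ≤ 1 - (K - 1) * s + ((K - 1) * s) ^ 2) (hδ' : δ * (1 + 2 * K * s) ≤ δ') :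
    B' * (1 - δ') / (B * (1 - δ))
      ≤ 1 - (1 + μ) * (s * ((K - 1) * (B * (1 + δ))) / (B * (1 - δ))) := by
  have hKs0 : 0 ≤ K * s := by positivity
  have hKs : K * s ≤ 1 / 16 := by nlinarith
  have hx : 0 ≤ 1 - δ * (1 + 2 * K * s) := by nlinarith
  have hPu : P * (1 - δ') ≤ (1 - (K - 1) * s + ((K - 1) * s) ^ 2) * (1 - δ * (1 + 2 * K * s)) :=
    (mul_le_mul_of_nonneg_left (by linarith) hP0).trans (mul_le_mul_of_nonneg_right hP hx)
  have hδp : 0 < 1 - δ := by linarith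
  have key : P * (1 - δ') ≤ (1 - δ) - (1 + μ) * (s * ((K - 1) * (1 + δ))) := by
    refine hPu.trans ?_
    have e : (1 - δ) - (1 + μ) * (s * ((K - 1) * (1 + δ))) -
      (1 - (K - 1) * s + ((K - 1) * s) ^ 2) * (1 - δ * (1 + 2 * K * s)) =
      s * (2 * δ - 2 * K * (K - 1) * s * δ - (K - 1) ^ 2 * s * (1 - δ * (1 + 2 * K * s))
        - μ * ((K - 1) * (1 + δ))) := by ring
    have h1 : 2 * K * (K - 1) * s * δ ≤ δ / 4 := by
      have h2 : K * (K - 1) * s ≤ K ^ 2 * s := mul_le_mul_of_nonneg_right (by nlinarith) hs0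
      have h3 : K * (K - 1) * s ≤ 1 / 8 := by linarith
      nlinarith
    have h4 : μ * ((K - 1) * (1 + δ)) ≤ δ / 4 := by
      have : (K - 1) * (1 + δ) ≤ 2 * K := by nlinarith
      nlinarith
    have h5 : (K - 1) ^ 2 * s * (1 - δ * (1 + 2 * K * s)) ≤ δ / 8 := by
      have h6 : (K - 1) ^ 2 * s ≤ K ^ 2 * s := mul_le_mul_of_nonneg_right (by nlinarith) hs0
      have h7 : 0 ≤ (K - 1) ^ 2 * s := by positivity
      have h8 : 1 - δ * (1 + 2 * K * s) ≤ 1 := by nlinarith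
      exact (mul_le_of_le_one_right h7 h8).trans (h6.trans hs)
    have := mul_nonneg hs0 (show 0 ≤ 2 * δ - 2 * K * (K - 1) * s * δ -
      (K - 1) ^ 2 * s * (1 - δ * (1 + 2 * K * s)) - μ * ((K - 1) * (1 + δ)) by linarith)
    linarith
  rw [hB']
  have e1 : s * ((K - 1) * (B * (1 + δ))) / (B * (1 - δ))
      = s * ((K - 1) * (1 + δ)) / (1 - δ) := by field_simp
  have e2 : B * P * (1 - δ') / (B * (1 - δ)) = P * (1 - δ') / (1 - δ) := by field_simp
  rw [e1, e2, div_le_iff₀ hδp]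
  have e3 : (1 - (1 + μ) * (s * ((K - 1) * (1 + δ)) / (1 - δ))) * (1 - δ)
      = (1 - δ) - (1 + μ) * (s * ((K - 1) * (1 + δ))) := by field_simp
  rw [e3]; exact key

/-- The envelope of the uncovered part of a tracked set dominates its drift. -/
theorem cover_envelope_step {K s δ δ' μ B A A' : ℝ} (hK : 2 ≤ K) (hs0 : 0 ≤ s) (hδ0 : 0 < δ)
    (hδ1 : δ ≤ 1 / 2) (hB : 0 < B) (hA : 0 < A) (hμ0 : 0 ≤ μ) (hμ : K * μ ≤ δ / 8)
    (hs : K ^ 2 * s ≤ δ / 8) (hA' : A' = A * (1 - s)) (hδ' : δ * (1 + 2 * K * s) ≤ δ') :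
    1 - (1 - μ) * (s * (B * (1 - δ)) / (B * (1 + δ))) ≤ A' * (1 + δ') / (A * (1 + δ)) := by
  have hKs0 : 0 ≤ K * s := by positivity
  have hKs : K * s ≤ 1 / 16 := by nlinarith
  have hδp : 0 < 1 + δ := by linarith
  have key : (1 + δ) - (1 - μ) * (s * (1 - δ)) ≤ (1 - s) * (1 + δ') := by
    have hs1 : 0 ≤ 1 - s := by nlinarith
    refine le_trans ?_ (mul_le_mul_of_nonneg_left (add_le_add_right hδ' 1) hs1)
    have e : (1 - s) * (1 + δ * (1 + 2 * K * s)) - ((1 + δ) - (1 - μ) * (s * (1 - δ)))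
      = s * (2 * (K - 1) * δ - 2 * (K * s) * δ - μ * (1 - δ)) := by ring
    have h1 : μ * (1 - δ) ≤ δ / 8 := by nlinarith
    have h2 : 2 * δ ≤ 2 * (K - 1) * δ := by nlinarith
    have h3 : 2 * (K * s) * δ ≤ δ := by nlinarith
    have := mul_nonneg hs0 (show 0 ≤ 2 * (K - 1) * δ - 2 * (K * s) * δ - μ * (1 - δ) by linarith)
    linarith
  rw [hA']
  have e1 : s * (B * (1 - δ)) / (B * (1 + δ)) = s * (1 - δ) / (1 + δ) := by field_simp
  have e2 : A * (1 - s) * (1 + δ') / (A * (1 + δ)) = (1 - s) * (1 + δ') / (1 + δ) := by field_simp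
  rw [e1, e2, le_div_iff₀ hδp]
  have e3 : (1 - (1 - μ) * (s * (1 - δ) / (1 + δ))) * (1 + δ)
      = (1 + δ) - (1 - μ) * (s * (1 - δ)) := by field_simp
  rw [e3]; exact key

section Hypergraph

variable {α β : Type*} [DecidableEq α]

/-- The potential with the envelopes used when a proportion `p` of the vertices is left. -/
noncomputable def hpotAt {ι : Type*} (V : Finset α) (H : Finset β) (c : β → Finset α)
    (F : Finset ι) (S : ι → Finset α) (k : ℕ) (lam D m δ p : ℝ) : ℝ :=
  hpot V H c F S lam (D * p ^ (k - 1) * (1 + relErr δ k p))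
    (D * p ^ (k - 1) * (1 - relErr δ k p)) (m * p * (1 + relErr δ k p))

theorem relErr_le_half {δ q p : ℝ} {k : ℕ} (hδ : 0 ≤ δ) (hq : 0 < q) (hqp : q ≤ p)
    (h : δ / q ^ (2 * k) ≤ 1 / 2) : relErr δ k p ≤ 1 / 2 := by
  refine le_trans ?_ h
  unfold relErr
  gcongr

theorem le_relErr {δ p : ℝ} {k : ℕ} (hδ : 0 ≤ δ) (hp : 0 < p) (hp1 : p ≤ 1) :
    δ ≤ relErr δ k p := by
  unfold relErr
  rw [le_div_iff₀ (pow_pos hp _)]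
  exact mul_le_of_le_one_right hδ (pow_le_one₀ hp.le hp1)

theorem exists_hpotAt_lt_one {ι : Type*} (V : Finset α) (H : Finset β) (c : β → Finset α)
    (F : Finset ι) (S : ι → Finset α) {k C : ℕ} {lam D m δ N q p : ℝ} (hk : 2 ≤ k)
    (hlam : 1 ≤ lam) (hD : 0 < D) (hm : 0 < m) (hδ0 : 0 < δ) (hN : 0 < N) (hq : 0 < q)
    (hδq : δ / q ^ (2 * k) ≤ 1 / 2)
    (hC : 16 * k ^ 2 * lam * C ≤ δ * D * q ^ k) (hNq : 8 * k ^ 3 ≤ δ * N * q)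
    (hmq : 8 * k ^ 2 * lam ≤ δ * m * q)
    (hcV : ∀ Q ∈ H, c Q ⊆ V) (hck : ∀ Q ∈ H, #(c Q) = k)
    (hcod : ∀ u v, u ≠ v → hcodeg H c u v ≤ C) (hp1 : p ≤ 1) (hpq : q ≤ p - k / N)
    (hV : (#V : ℝ) = N * p) (hpot : hpotAt V H c F S k lam D m δ p < 1) :
    ∃ Q ∈ H, hpotAt (V \ c Q) (hres H c Q) c F S k lam D m δ (p - k / N) < 1 := by
  have hK : (2 : ℝ) ≤ k := by exact_mod_cast hk
  have hkN : (0 : ℝ) < k / N := by positivity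
  have hqp : q ≤ p := by linarith
  have hp : 0 < p := hq.trans_le hqp
  have hp' : 0 < p - k / N := hq.trans_le hpq
  obtain ⟨s, hs⟩ : ∃ s : ℝ, s = k / (N * p) := ⟨_, rfl⟩
  have hs0 : 0 < s := by rw [hs]; positivity
  have hp's : p - k / N = p * (1 - s) := by rw [hs]; field_simp
  have hs1 : s < 1 := by
    rw [hp's] at hp'
    by_contra h
    have := mul_nonneg hp.le (show 0 ≤ s - 1 by linarith [not_lt.1 h])
    linarith
  rw [hp's] at hpq hp' ⊢
  unfold hpotAt at hpot ⊢
  have hq1 : q ≤ 1 := hqp.trans hp1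
  set d := relErr δ k p with hd
  set d' := relErr δ k (p * (1 - s)) with hd'
  have hdd' : d * (1 + 2 * k * s) ≤ d' := relErr_step k hδ0.le hp hs0.le hs1
  have hδd : δ ≤ d := le_relErr hδ0.le hp hp1
  have hd0 : 0 < d := hδ0.trans_le hδd
  have hdhalf : d ≤ 1 / 2 := relErr_le_half hδ0.le hq hqp hδq
  have hd'half : d' ≤ 1 / 2 := relErr_le_half hδ0.le hq hpq hδq
  have hd'0 : 0 < d' := lt_of_lt_of_le (by positivity) hdd'
  have hδhalf : δ ≤ 1 / 2 := hδd.trans hdhalf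
  have hqk : ∀ x, q ≤ x → q ^ k ≤ x ^ (k - 1) := fun x hx =>
    (pow_le_pow_of_le_one hq.le hq1 (Nat.sub_le k 1)).trans (pow_le_pow_left₀ hq.le hx _)
  set B := D * p ^ (k - 1) with hB
  set B' := D * (p * (1 - s)) ^ (k - 1) with hB'
  have hBpos : 0 < B := by positivity
  have hB'pos : 0 < B' := by positivity
  have hDB : D * q ^ k ≤ B := mul_le_mul_of_nonneg_left (hqk p hqp) hD.le
  have hDB' : D * q ^ k ≤ B' := mul_le_mul_of_nonneg_left (hqk _ hpq) hD.le
  have hBB' : B' = B * (1 - s) ^ (k - 1) := by rw [hB, hB', mul_pow]; ring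
  clear_value d d' B B'
  obtain ⟨μ, hμ⟩ : ∃ μ : ℝ, μ = δ / (8 * k) := ⟨_, rfl⟩
  have hμ0 : 0 ≤ μ := by rw [hμ]; positivity
  have hμk : k * μ = δ / 8 := by rw [hμ]; field_simp
  have hμ1 : μ ≤ 1 := by nlinarith
  have hC0 : (0 : ℝ) ≤ C := by positivity
  have hCB : 16 * k ^ 2 * lam * C ≤ δ * B := hC.trans (by rw [mul_assoc δ]; exact mul_le_mul_of_nonneg_left hDB hδ0.le)
  have hCB' : 16 * k ^ 2 * lam * C ≤ δ * B' :=
    hC.trans (by rw [mul_assoc δ]; exact mul_le_mul_of_nonneg_left hDB' hδ0.le)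
  have hCk : (k : ℝ) ^ 2 * C ≤ d / 8 * B := by
    have h1 : (k : ℝ) ^ 2 * C ≤ k ^ 2 * lam * C := by
      rw [mul_right_comm]
      exact le_mul_of_one_le_right (by positivity) hlam
    have h2 : δ * B ≤ d * B := mul_le_mul_of_nonneg_right hδd hBpos.le
    have h3 : 0 ≤ d * B := by positivity
    linarith
  have hsk : (k : ℝ) ^ 2 * s ≤ d / 8 := by
    rw [hs, ← mul_div_assoc, div_le_iff₀ (by positivity)]
    have h1 : δ * N * q ≤ d * N * p := by gcongr
    linarith
  have hμd : k * μ ≤ d / 8 := by rw [hμk]; linarith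
  have hμx : ∀ x, B' / 2 ≤ x → lam * (k * C) ≤ μ * x := by
    intro x hx
    have h1 : μ * (B' / 2) ≤ μ * x := mul_le_mul_of_nonneg_left hx hμ0
    refine le_trans ?_ h1
    rw [hμ, div_mul_div_comm, le_div_iff₀ (by positivity)]
    linarith
  have hcast : ((k - 1 : ℕ) : ℝ) = (k : ℝ) - 1 := by
    rw [Nat.cast_sub (by omega)]; simp
  have hPl : 1 - ((k : ℝ) - 1) * s ≤ (1 - s) ^ (k - 1) := by
    have := one_add_mul_le_pow (show (-2 : ℝ) ≤ -s by linarith) (k - 1)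
    rw [hcast] at this
    rw [sub_eq_add_neg 1 s]
    linarith
  have hPu : (1 - s) ^ (k - 1) ≤ 1 - ((k : ℝ) - 1) * s + (((k : ℝ) - 1) * s) ^ 2 := by
    have := one_sub_pow_le (k - 1) hs0.le hs1.le
    rwa [hcast] at this
  have hpospot := lt_of_hpot_lt_one (by linarith) (by positivity)
    (mul_pos hBpos (by linarith)) (by positivity) hpot
  have hVne : V.Nonempty := by
    rw [← Finset.card_pos]
    have : (0 : ℝ) < #V := by rw [hV]; positivity
    exact_mod_cast this
  have hU'2 : B' / 2 ≤ B' * (1 + d') := by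
    have : 0 ≤ B' * d' := by positivity
    linarith
  have hL'2 : B' / 2 ≤ B' * (1 - d') := by
    have := mul_nonneg hB'pos.le (show 0 ≤ 1 / 2 - d' by linarith)
    linarith
  have hμW : lam * k ≤ μ * (m * (p * (1 - s)) * (1 + d')) := by
    have h1 : m * q ≤ m * (p * (1 - s)) * (1 + d') := by
      have h2 : m * q ≤ m * (p * (1 - s)) := mul_le_mul_of_nonneg_left hpq hm.le
      have h3 : 0 ≤ m * (p * (1 - s)) * d' := by positivity
      linarith
    refine le_trans ?_ (mul_le_mul_of_nonneg_left h1 hμ0)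
    rw [hμ, div_mul_eq_mul_div, le_div_iff₀ (by positivity)]
    linarith
  have hposk : 0 ≤ ((k : ℝ) - 1) * (B * (1 - d)) - k ^ 2 * C := by
    have h1 : B / 2 ≤ B * (1 - d) := by
      have := mul_nonneg hBpos.le (show 0 ≤ 1 / 2 - d by linarith)
      linarith
    have h2 : B * (1 - d) ≤ (k - 1) * (B * (1 - d)) :=
      le_mul_of_one_le_left (by linarith) (by linarith)
    have h3 : d / 8 * B ≤ 1 / 16 * B := mul_le_mul_of_nonneg_right (by linarith) hBpos.le
    linarith
  obtain ⟨Q, hQ, hQle⟩ := exists_hpot_le (k := k) (C := C) (lam := lam) (μ := μ) (s := s)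
    (U := B * (1 + d)) (L := B * (1 - d)) (W := m * p * (1 + d))
    (U' := B' * (1 + d')) (L' := B' * (1 - d')) (W' := m * (p * (1 - s)) * (1 + d'))
    V H c F S (by omega) hVne hcV hck hcod
    (fun v hv => (hpospot.1 v hv).2.le) (fun v hv => (hpospot.1 v hv).1.le)
    (by rw [hV, hs]; field_simp) (by linarith) (mul_pos hBpos (by linarith)) (by positivity)
    (by positivity) (mul_pos hB'pos (by linarith)) (by positivity) hμ0 hμ1
    (hμx _ hU'2) (hμx _ hL'2) hμW hposk
    (upper_envelope_step hK hs0.le hd0 hdhalf hBpos hC0 hμ0 hμd hsk hCk hBB' hPl hdd')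
    (lower_envelope_step hK hs0.le hd0 hdhalf hBpos hμ0 hμd hsk hBB'
      (pow_nonneg (by linarith) _) hPu hdd')
    (cover_envelope_step hK hs0.le hd0 hdhalf hBpos (by positivity) hμ0 hμd hsk (by ring) hdd')
  exact ⟨Q, hQ, hQle.trans_lt hpot⟩

/-- The random greedy matching, derandomized. -/
theorem exists_greedy_matching {ι : Type*} [DecidableEq β] (G : Finset α) (H : Finset β)
    (c : β → Finset α) (F : Finset ι) (S : ι → Finset α) {k C : ℕ} {lam D m δ q : ℝ} (hk : 2 ≤ k)
    (hlam : 1 ≤ lam) (hD : 0 < D) (hm : 0 < m) (hδ0 : 0 < δ) (hG : G.Nonempty) (hq : 0 < q)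
    (hδq : δ / q ^ (2 * k) ≤ 1 / 2)
    (hC : 16 * k ^ 2 * lam * C ≤ δ * D * q ^ k) (hNq : 8 * k ^ 3 ≤ δ * #G * q)
    (hmq : 8 * k ^ 2 * lam ≤ δ * m * q)
    (hcG : ∀ Q ∈ H, c Q ⊆ G) (hck : ∀ Q ∈ H, #(c Q) = k)
    (hcod : ∀ u v, u ≠ v → hcodeg H c u v ≤ C) (hinit : hpotAt G H c F S k lam D m δ 1 < 1)
    (i : ℕ) (hi : q ≤ 1 - i * (k / #G)) :
    ∃ M ⊆ H, (∀ Q ∈ M, ∀ Q' ∈ M, Q ≠ Q' → Disjoint (c Q) (c Q')) ∧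
      (#(G \ M.biUnion c) : ℝ) = #G * (1 - i * (k / #G)) ∧
      hpotAt (G \ M.biUnion c) {Q ∈ H | Disjoint (c Q) (M.biUnion c)} c F S k lam D m δ
        (1 - i * (k / #G)) < 1 := by
  have hN : (0 : ℝ) < #G := by exact_mod_cast Finset.card_pos.2 hG
  induction i with
  | zero => exact ⟨∅, by simp, by simp, by simp, by simpa using hinit⟩
  | succ i ih =>
    have hstep : (1 : ℝ) - (i + 1 : ℕ) * (k / #G) = 1 - i * (k / #G) - k / #G := by
      push_cast; ring
    rw [hstep] at hi ⊢
    have hkN : (0 : ℝ) ≤ k / #G := by positivity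
    obtain ⟨M, hMH, hMd, hMc, hMp⟩ := ih (by linarith)
    set V := G \ M.biUnion c with hV
    set R : Finset β := {Q ∈ H | Disjoint (c Q) (M.biUnion c)} with hR
    have hRV : ∀ Q ∈ R, c Q ⊆ V := by
      intro Q hQ
      rw [hR, mem_filter] at hQ
      exact Finset.subset_sdiff.2 ⟨hcG Q hQ.1, hQ.2⟩
    have hRk : ∀ Q ∈ R, #(c Q) = k := fun Q hQ => hck Q (mem_filter.1 hQ).1
    have hRC : ∀ u v, u ≠ v → hcodeg R c u v ≤ C := fun u v huv =>
      (Finset.card_le_card (Finset.filter_subset_filter _ (Finset.filter_subset _ _))).trans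
        (hcod u v huv)
    obtain ⟨Q, hQ, hQp⟩ := exists_hpotAt_lt_one V R c F S hk hlam hD hm hδ0 hN hq hδq hC hNq hmq
      hRV hRk hRC (by have : (0 : ℝ) ≤ i * (k / #G) := by positivity
                      linarith) hi hMc hMp
    have hQ' := hQ
    rw [hR, mem_filter] at hQ'
    have hQM : ∀ Q' ∈ M, Disjoint (c Q) (c Q') := fun Q' hQ'' =>
      hQ'.2.mono_right (Finset.subset_biUnion_of_mem c hQ'')
    have hVeq : G \ (insert Q M).biUnion c = V \ c Q := by
      rw [Finset.biUnion_insert, hV]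
      ext x; simp only [mem_sdiff, mem_union]; tauto
    have hReq : ({Q' ∈ H | Disjoint (c Q') ((insert Q M).biUnion c)} : Finset β)
        = hres R c Q := by
      ext Q'
      simp only [hres, hR, mem_filter, Finset.biUnion_insert, Finset.disjoint_union_right]
      tauto
    refine ⟨insert Q M, Finset.insert_subset hQ'.1 hMH, ?_, ?_, ?_⟩
    · intro Q₁ h₁ Q₂ h₂ hne
      rcases Finset.mem_insert.1 h₁ with e₁ | m₁ <;> rcases Finset.mem_insert.1 h₂ with e₂ | m₂
      · exact absurd (e₁.trans e₂.symm) hne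
      · exact e₁ ▸ hQM _ m₂
      · exact e₂ ▸ (hQM _ m₁).symm
      · exact hMd _ m₁ _ m₂ hne
    · rw [hVeq, Finset.cast_card_sdiff (hRV Q hQ), hMc, hRk Q hQ]
      field_simp
    · rw [hVeq, hReq]; exact hQp

/-- A nearly regular uniform hypergraph with small codegrees has a matching covering almost all of
each of a given family of vertex sets. -/
theorem exists_matching_card_uncovered_le {ι : Type*} [DecidableEq β] (G : Finset α) (H : Finset β)
    (c : β → Finset α) (F : Finset ι) (S : ι → Finset α) {k C : ℕ} {lam D m δ q : ℝ} (hk : 2 ≤ k)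
    (hlam : 1 ≤ lam) (hD : 0 < D) (hm : 0 < m) (hδ0 : 0 < δ) (hG : G.Nonempty) (hq : 0 < q)
    (hq1 : q ≤ 1) (hδq : δ / q ^ (2 * k) ≤ 1 / 2)
    (hC : 16 * k ^ 2 * lam * C ≤ δ * D * q ^ k) (hNq : 8 * k ^ 3 ≤ δ * #G * q)
    (hmq : 8 * k ^ 2 * lam ≤ δ * m * q)
    (hcG : ∀ Q ∈ H, c Q ⊆ G) (hck : ∀ Q ∈ H, #(c Q) = k)
    (hcod : ∀ u v, u ≠ v → hcodeg H c u v ≤ C)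
    (hreg : ∀ v ∈ G, |(hdeg H c v : ℝ) - D| ≤ δ / 2 * D)
    (hS : ∀ f ∈ F, (#(G ∩ S f) : ℝ) ≤ m)
    (hexp : (2 * #G + #F) * Real.exp (-(lam * δ / 4)) < 1) :
    ∃ M ⊆ H, (∀ Q ∈ M, ∀ Q' ∈ M, Q ≠ Q' → Disjoint (c Q) (c Q')) ∧
      ∀ f ∈ F, (#((G \ M.biUnion c) ∩ S f) : ℝ) ≤ 3 * (m * q) := by
  have hN : (0 : ℝ) < #G := by exact_mod_cast Finset.card_pos.2 hG
  have hK : (2 : ℝ) ≤ k := by exact_mod_cast hk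
  have hδhalf : δ ≤ 1 / 2 := by
    have h1 := relErr_le_half hδ0.le hq hq1 hδq
    unfold relErr at h1
    simpa using h1
  have hlam0 : 0 < lam := by linarith
  have hinit : hpotAt G H c F S k lam D m δ 1 < 1 := by
    refine lt_of_le_of_lt ?_ hexp
    have hr : relErr δ k 1 = δ := by simp [relErr]
    unfold hpotAt hpot
    rw [hr]
    simp only [one_pow, mul_one]
    have hbound : ∀ x : ℝ, x ≤ -(δ / 4) → Real.exp (lam * x) ≤ Real.exp (-(lam * δ / 4)) := by
      intro x hx
      refine Real.exp_le_exp.2 ?_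
      have := mul_le_mul_of_nonneg_left hx hlam0.le
      linarith
    have h1 : ∑ v ∈ G, Real.exp (lam * ((hdeg H c v : ℝ) / (D * (1 + δ)) - 1))
        ≤ #G * Real.exp (-(lam * δ / 4)) := by
      rw [← nsmul_eq_mul]
      refine Finset.sum_le_card_nsmul _ _ _ fun v hv => hbound _ ?_
      have h2 := (abs_le.1 (hreg v hv)).2
      rw [sub_le_iff_le_add, div_le_iff₀ (by positivity)]
      have h3 : 0 ≤ δ * D * (1 / 2 - δ) := mul_nonneg (by positivity) (by linarith)
      have h4 : 0 ≤ δ * D := by positivity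
      linarith
    have h2 : ∑ v ∈ G, Real.exp (lam * (1 - (hdeg H c v : ℝ) / (D * (1 - δ))))
        ≤ #G * Real.exp (-(lam * δ / 4)) := by
      rw [← nsmul_eq_mul]
      refine Finset.sum_le_card_nsmul _ _ _ fun v hv => hbound _ ?_
      have h2 := (abs_le.1 (hreg v hv)).1
      have h3 : 1 + δ / 4 ≤ (hdeg H c v : ℝ) / (D * (1 - δ)) := by
        rw [le_div_iff₀ (mul_pos hD (by linarith))]
        have h4 : 0 ≤ δ ^ 2 * D := by positivity
        have h5 : 0 ≤ δ * D := by positivity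
        linarith
      linarith
    have h3 : ∑ f ∈ F, Real.exp (lam * ((#(G ∩ S f) : ℝ) / (m * (1 + δ)) - 1))
        ≤ #F * Real.exp (-(lam * δ / 4)) := by
      rw [← nsmul_eq_mul]
      refine Finset.sum_le_card_nsmul _ _ _ fun f hf => hbound _ ?_
      have h2 := hS f hf
      rw [sub_le_iff_le_add, div_le_iff₀ (by positivity)]
      have h3 : 0 ≤ δ * m * (1 / 2 - δ) := mul_nonneg (by positivity) (by linarith)
      have h4 : 0 ≤ δ * m := by positivity
      linarith
    linarith
  have hkN : (0 : ℝ) < k / #G := by positivity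
  have hkNq : (k : ℝ) / #G ≤ q := by
    rw [div_le_iff₀ hN]
    have h1 : δ * #G * q ≤ q * #G := by
      have : 0 ≤ q * (#G : ℝ) := by positivity
      nlinarith
    have h2 : (k : ℝ) ≤ 8 * k ^ 3 := by
      have h3 : (k : ℝ) ≤ k ^ 3 := le_self_pow₀ (by linarith) (by norm_num)
      have h4 : (0 : ℝ) ≤ k ^ 3 := by positivity
      linarith
    linarith
  set i := ⌊(1 - q) / (k / #G)⌋₊ with hi
  have hi1 : (i : ℝ) * (k / #G) ≤ 1 - q := by
    rw [← le_div_iff₀ hkN]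
    exact Nat.floor_le (div_nonneg (by linarith) hkN.le)
  have hi2 : 1 - q < (i + 1) * (k / #G) := by
    rw [← div_lt_iff₀ hkN]
    exact Nat.lt_floor_add_one _
  have hqi : q ≤ 1 - i * (k / #G) := by linarith
  obtain ⟨M, hMH, hMd, -, hMp⟩ := exists_greedy_matching G H c F S hk hlam hD hm hδ0 hG hq hδq hC
    hNq hmq hcG hck hcod hinit i hqi
  refine ⟨M, hMH, hMd, fun f hf => ?_⟩
  set p := 1 - i * (k / #G : ℝ) with hp
  have hp0 : 0 < p := hq.trans_le hqi
  have hr := relErr_le_half hδ0.le hq hqi hδq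
  have hr0 : 0 ≤ relErr δ k p := by unfold relErr; positivity
  have h1 := (lt_of_hpot_lt_one hlam0 (by positivity)
    (mul_pos (by positivity) (by linarith)) (by positivity) hMp).2 f hf
  have hp2 : p ≤ 2 * q := by linarith
  have h2 : m * p * (1 + relErr δ k p) ≤ m * (2 * q) * (1 + 1 / 2) := by gcongr
  linarith

end Hypergraph

theorem card_filter_superset_le {n j : ℕ} (T : Finset (Finset (Fin n))) (B : Finset (Fin n))
    (hT : ∀ A ∈ T, #A = j) : #{A ∈ T | B ⊆ A} ≤ n ^ (j - #B) := by
  calc #{A ∈ T | B ⊆ A} ≤ #(powersetCard (j - #B) (univ : Finset (Fin n))) := by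
        refine Finset.card_le_card_of_injOn (fun A => A \ B) ?_ ?_
        · intro A hA
          rw [mem_coe, mem_filter] at hA
          simp [mem_powersetCard, Finset.card_sdiff_of_subset hA.2, hT A hA.1]
        · intro A hA A' hA' h
          rw [mem_coe, mem_filter] at hA hA'
          rw [← Finset.sdiff_union_of_subset hA.2, ← Finset.sdiff_union_of_subset hA'.2]
          exact congrArg (· ∪ B) h
    _ = n.choose (j - #B) := by simp
    _ ≤ n ^ (j - #B) := Nat.choose_le_pow _ _

theorem pow_le_mul_choose {n j : ℕ} (h : 2 * j ≤ n) :
    (n : ℝ) ^ j ≤ 2 ^ j * j.factorial * n.choose j := by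
  have h1 := Nat.pow_le_choose (α := ℝ) j n
  rw [div_le_iff₀' (by positivity)] at h1
  have h2 : (n : ℝ) ≤ 2 * ((n + 1 - j : ℕ) : ℝ) := by
    have : n ≤ 2 * (n + 1 - j) := by omega
    exact_mod_cast this
  calc (n : ℝ) ^ j ≤ (2 * ((n + 1 - j : ℕ) : ℝ)) ^ j := by gcongr
    _ = 2 ^ j * ((n + 1 - j : ℕ) : ℝ) ^ j := mul_pow _ _ _
    _ ≤ 2 ^ j * (j.factorial * n.choose j) := by gcongr
    _ = _ := by ring

theorem eventually_mul_rpow_le (K : ℝ) {a b : ℝ} (hab : a < b) :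
    ∀ᶠ n : ℕ in Filter.atTop, K * (n : ℝ) ^ a ≤ (n : ℝ) ^ b := by
  have h1 := ((tendsto_rpow_atTop (sub_pos.2 hab)).comp
    (tendsto_natCast_atTop_atTop (R := ℝ))).eventually_ge_atTop K
  filter_upwards [h1, Filter.eventually_gt_atTop 0] with n hn hn0
  have hx : (0 : ℝ) < n := by exact_mod_cast hn0
  have h2 : (n : ℝ) ^ b = (n : ℝ) ^ (b - a) * (n : ℝ) ^ a := by
    rw [← Real.rpow_add hx]; congr 1; ring
  rw [h2]
  exact mul_le_mul_of_nonneg_right hn (by positivity)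

theorem eventually_pow_mul_exp_lt (K : ℝ) (r : ℕ) {t b : ℝ} (ht : 0 < t) (hb : 0 < b) :
    ∀ᶠ n : ℕ in Filter.atTop, K * (n : ℝ) ^ r * Real.exp (-b * (n : ℝ) ^ t) < 1 := by
  have h1 := ((tendsto_rpow_mul_exp_neg_mul_atTop_nhds_zero (r / t) b hb).comp
    ((tendsto_rpow_atTop ht).comp (tendsto_natCast_atTop_atTop (R := ℝ)))).const_mul K
  rw [mul_zero] at h1
  filter_upwards [h1.eventually_lt_const one_pos] with n hn
  simp only [Function.comp_apply] at hn
  rw [← Real.rpow_mul (Nat.cast_nonneg n), mul_div_cancel₀ _ ht.ne', Real.rpow_natCast] at hn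
  linarith

theorem two_le_choose {q r : ℕ} (hqr : r < q) (hr : 1 ≤ r) : 2 ≤ q.choose r := by
  obtain ⟨q, rfl⟩ := Nat.exists_eq_succ_of_ne_zero (show q ≠ 0 by omega)
  obtain ⟨r, rfl⟩ := Nat.exists_eq_succ_of_ne_zero (show r ≠ 0 by omega)
  rw [Nat.choose_succ_succ]
  have h1 := Nat.choose_pos (n := q) (k := r) (by omega)
  have h2 := Nat.choose_pos (n := q) (k := r.succ) (by omega)
  omega

/-- Two distinct `r`-sets lie in few common `q`-cliques. -/
theorem hcodeg_powersetCard_le {n q r : ℕ} (H : Finset (Finset (Fin n))) (hH : ∀ Q ∈ H, #Q = q)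
    (hn : 0 < n) {u v : Finset (Fin n)} (huv : u ≠ v) :
    hcodeg H (powersetCard r) u v ≤ n ^ (q - r - 1) := by
  unfold hcodeg
  by_cases hc : #u = r ∧ #v = r
  · have hcard : r + 1 ≤ #(u ∪ v) := by
      by_contra h
      have h1 : u ∪ v = u := (Finset.eq_of_subset_of_card_le subset_union_left (by omega)).symm
      have h2 : u ∪ v = v := (Finset.eq_of_subset_of_card_le subset_union_right (by omega)).symm
      exact huv (h1.symm.trans h2)
    calc #{Q ∈ H | u ∈ powersetCard r Q ∧ v ∈ powersetCard r Q} ≤ #{Q ∈ H | u ∪ v ⊆ Q} := by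
          refine Finset.card_le_card fun Q hQ => ?_
          simp only [mem_filter, mem_powersetCard] at hQ ⊢
          exact ⟨hQ.1, union_subset hQ.2.1.1 hQ.2.2.1⟩
      _ ≤ n ^ (q - #(u ∪ v)) := card_filter_superset_le H _ hH
      _ ≤ n ^ (q - r - 1) := Nat.pow_le_pow_right hn (by omega)
  · rw [Finset.filter_false_of_mem]
    · simp
    · rintro Q - ⟨h1, h2⟩
      exact hc ⟨(mem_powersetCard.1 h1).2, (mem_powersetCard.1 h2).2⟩

/-- the clique removal process / nibble: let `G ⊆ K^r_n` with
`|G| = φ C(n,r)` and `H ⊆ K^r_q(G)` with `|H(e)| = (1 ± n^{-ε}) θ C(n,q-r)` for all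
`e ∈ G`, where `ε < 0.4`, `θ ≥ n^{-1/3}`, `φ ≥ n^{-r/3}` and `n` is sufficiently
large. Then there is a set `H' ⊆ H` of pairwise edge-disjoint `q`-cliques such that
every `(r-1)`-subset of `[n]` lies in at most `3n^{1-ε/(3k)}` edges of `G \ ∪H'`,
with `k = C(q,r)`. -/
theorem stmt19 (q r : ℕ) (hqr : r < q) (hr : 1 ≤ r) (ε : ℝ) (hε0 : 0 < ε)
    (hε : ε < 0.4) :
    ∃ n₀ : ℕ, ∀ n : ℕ, n₀ ≤ n → ∀ θ φ : ℝ,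
      (n : ℝ) ^ (-(1 : ℝ) / 3) ≤ θ → (n : ℝ) ^ (-(r : ℝ) / 3) ≤ φ →
      ∀ G : Finset (Finset (Fin n)), (∀ e ∈ G, e.card = r) →
      (G.card : ℝ) = φ * (n.choose r : ℝ) →
      ∀ H : Finset (Finset (Fin n)),
      (∀ Q ∈ H, Q.card = q ∧ ∀ e ⊆ Q, e.card = r → e ∈ G) →
      (∀ e ∈ G, |((H.filter (fun Q => e ⊆ Q)).card : ℝ) - θ * (n.choose (q - r) : ℝ)|
          ≤ (n : ℝ) ^ (-ε) * (θ * (n.choose (q - r) : ℝ))) →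
      ∃ H' ⊆ H,
        (∀ Q ∈ H', ∀ Q' ∈ H', Q ≠ Q' →
          ∀ e : Finset (Fin n), e.card = r → ¬(e ⊆ Q ∧ e ⊆ Q')) ∧
        ∀ f : Finset (Fin n), f.card = r - 1 →
          ((G.filter (fun e => f ⊆ e ∧ ∀ Q ∈ H', ¬e ⊆ Q)).card : ℝ)
            ≤ 3 * (n : ℝ) ^ (1 - ε / (3 * (q.choose r : ℝ))) := by
  norm_num at hε
  obtain ⟨k, hk⟩ : ∃ k, k = q.choose r := ⟨_, rfl⟩
  have hk2 : 2 ≤ k := hk ▸ two_le_choose hqr hr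
  rw [← hk]
  have hkR : (2 : ℝ) ≤ k := by exact_mod_cast hk2
  obtain ⟨m, hm⟩ : ∃ m, q - r = m + 1 := ⟨q - r - 1, by omega⟩
  obtain ⟨t, ht⟩ : ∃ t, t = min (ε / 6) ((2 - 5 * ε) / 12) := ⟨_, rfl⟩
  have ht0 : 0 < t := by rw [ht]; exact lt_min (by linarith) (by linarith)
  have ht1 : t ≤ ε / 6 := ht ▸ min_le_left _ _
  have ht2 : t ≤ (2 - 5 * ε) / 12 := ht ▸ min_le_right _ _
  obtain ⟨a, ha⟩ : ∃ a, a = 2 * ε / 3 + t := ⟨_, rfl⟩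
  obtain ⟨g, hg⟩ : ∃ g : ℝ, g = ε / (3 * k) := ⟨_, rfl⟩
  have hg0 : 0 < g := by rw [hg]; positivity
  have hgk : g * k = ε / 3 := by rw [hg]; field_simp
  have hg1 : g ≤ ε / 6 := by nlinarith
  rw [← hg]
  have hev := (eventually_mul_rpow_le 2 (show -ε < -a by linarith)).and <|
    (eventually_mul_rpow_le 2 (show -t < 0 by linarith)).and <|
    (eventually_mul_rpow_le (16 * k ^ 2 * (2 ^ (m + 1) * (m + 1).factorial))
      (show a + t + m < -a + -1 / 3 + (m + 1) + -(ε / 3) by linarith)).and <|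
    (eventually_mul_rpow_le (8 * k ^ 3 * (2 ^ r * r.factorial))
      (show (0 : ℝ) < -a + (2 / 3) + -g by linarith)).and <|
    (eventually_mul_rpow_le (8 * k ^ 2) (show a + t < -a + 1 + -g by linarith)).and <|
    (eventually_pow_mul_exp_lt 3 r ht0 (show (0 : ℝ) < 1 / 4 by norm_num)).and <|
    Filter.eventually_ge_atTop (2 * q + 1)
  obtain ⟨n₀, hn₀⟩ := Filter.eventually_atTop.1 hev
  refine ⟨n₀, fun n hn θ φ hθ hφ G hGr hGφ H hH hreg => ?_⟩
  obtain ⟨e1, e2, e3, e4, e5, e6, e7⟩ := hn₀ n hn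
  clear hev hn₀
  rcases G.eq_empty_or_nonempty with rfl | hGne
  · refine ⟨∅, by simp, by simp, fun f _ => ?_⟩
    simp only [filter_empty, card_empty, Nat.cast_zero]
    positivity
  have hn1 : 1 ≤ n := by omega
  obtain ⟨x, hx⟩ : ∃ x : ℝ, x = n := ⟨_, rfl⟩
  rw [← hx] at hθ hφ hreg e1 e2 e3 e4 e5 e6 ⊢
  have hx1 : 1 ≤ x := by rw [hx]; exact_mod_cast hn1
  have hx0 : 0 < x := by linarith
  rw [hm] at hreg
  obtain ⟨D, hD⟩ : ∃ D : ℝ, D = θ * n.choose (m + 1) := ⟨_, rfl⟩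
  rw [← hD] at hreg
  have hDlow : x ^ (-(1 : ℝ) / 3 + (m + 1)) ≤ 2 ^ (m + 1) * (m + 1).factorial * D := by
    have h1 := pow_le_mul_choose (n := n) (j := m + 1) (by omega)
    rw [← hx] at h1
    have h2 : x ^ (-(1 : ℝ) / 3 + (m + 1)) = x ^ (-(1 : ℝ) / 3) * x ^ (m + 1) := by
      rw [Real.rpow_add hx0, ← Real.rpow_natCast x (m + 1)]; push_cast; rfl
    have hθ0 : 0 ≤ θ := le_trans (by positivity) hθ
    rw [h2, hD]
    calc x ^ (-(1 : ℝ) / 3) * x ^ (m + 1)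
        ≤ θ * (2 ^ (m + 1) * (m + 1).factorial * n.choose (m + 1)) := by gcongr
      _ = _ := by ring
  have hDpos : 0 < D := by
    have h1 : 0 < x ^ (-(1 : ℝ) / 3 + (m + 1)) := by positivity
    exact pos_of_mul_pos_right (h1.trans_le hDlow) (by positivity)
  have hGlow : x ^ (2 / 3 : ℝ) ≤ 2 ^ r * r.factorial * #G := by
    have h1 := pow_le_mul_choose (n := n) (j := r) (by omega)
    rw [← hx] at h1
    have hrR : (1 : ℝ) ≤ r := by exact_mod_cast hr
    calc x ^ (2 / 3 : ℝ) ≤ x ^ (-(r : ℝ) / 3 + r) :=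
          Real.rpow_le_rpow_of_exponent_le hx1 (by linarith)
      _ = x ^ (-(r : ℝ) / 3) * x ^ r := by rw [Real.rpow_add hx0, Real.rpow_natCast]
      _ ≤ φ * (2 ^ r * r.factorial * n.choose r) := by
          have : 0 ≤ φ := le_trans (by positivity) hφ
          gcongr
      _ = _ := by rw [hGφ]; ring
  have hGupp : (#G : ℝ) ≤ x ^ r := by
    have h1 := card_filter_superset_le G ∅ hGr
    simp only [empty_subset, filter_true, card_empty, Nat.sub_zero] at h1
    rw [hx]; exact_mod_cast h1
  have hFupp : (#(powersetCard (r - 1) (univ : Finset (Fin n))) : ℝ) ≤ x ^ r := by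
    rw [card_powersetCard, card_univ, Fintype.card_fin, hx]
    have : n.choose (r - 1) ≤ n ^ r :=
      (Nat.choose_le_pow _ _).trans (Nat.pow_le_pow_right hn1 (Nat.sub_le _ _))
    exact_mod_cast this
  have hqk : (x ^ (-g)) ^ k = x ^ (-(ε / 3)) := by
    rw [← Real.rpow_natCast, ← Real.rpow_mul hx0.le]; congr 1; linarith
  have hq2k : (x ^ (-g)) ^ (2 * k) = x ^ (-(2 * ε / 3)) := by
    rw [← Real.rpow_natCast, ← Real.rpow_mul hx0.le]; congr 1; push_cast; linarith
  obtain ⟨M, hMH, hMd, hMc⟩ := exists_matching_card_uncovered_le (G := G) (H := H)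
    (c := powersetCard r) (F := powersetCard (r - 1) (univ : Finset (Fin n)))
    (S := fun f => {e ∈ G | f ⊆ e}) (k := k) (C := n ^ m) (lam := x ^ (a + t)) (D := D) (m := x)
    (δ := x ^ (-a)) (q := x ^ (-g)) hk2 (Real.one_le_rpow hx1 (by linarith)) hDpos hx0
    (by positivity) hGne (by positivity) (Real.rpow_le_one_of_one_le_of_nonpos hx1 (by linarith))
    (by
      rw [hq2k, ← Real.rpow_sub hx0, show -a - -(2 * ε / 3) = -t by linarith]
      rw [Real.rpow_zero] at e2
      linarith)
    (by
      rw [hqk]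
      push_cast
      rw [← hx]
      have hKp : (0 : ℝ) < 2 ^ (m + 1) * (m + 1).factorial := by positivity
      rw [Real.rpow_add hx0 _ (m : ℝ), Real.rpow_natCast, Real.rpow_add hx0 _ (-(ε / 3)),
        show -a + -1 / 3 + ((m : ℝ) + 1) = -a + (-1 / 3 + (m + 1)) by ring,
        Real.rpow_add hx0 (-a)] at e3
      refine le_of_mul_le_mul_left ?_ hKp
      have h1 : x ^ (-a) * x ^ (-1 / 3 + ((m : ℝ) + 1)) * x ^ (-(ε / 3)) ≤
        x ^ (-a) * (2 ^ (m + 1) * (m + 1).factorial * D) * x ^ (-(ε / 3)) := by gcongr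
      linarith)
    (by
      rw [Real.rpow_zero, mul_one, Real.rpow_add hx0, Real.rpow_add hx0] at e4
      have hKp : (0 : ℝ) < 2 ^ r * r.factorial := by positivity
      refine le_of_mul_le_mul_left ?_ hKp
      have h1 : x ^ (-a) * x ^ (2 / 3 : ℝ) * x ^ (-g) ≤
        x ^ (-a) * (2 ^ r * r.factorial * #G) * x ^ (-g) := by gcongr
      linarith)
    (by
      rw [Real.rpow_add hx0 _ (-g), Real.rpow_add hx0 (-a), Real.rpow_one] at e5
      exact e5)
    (fun Q hQ e he => (hH Q hQ).2 e (mem_powersetCard.1 he).1 (mem_powersetCard.1 he).2)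
    (fun Q hQ => by rw [card_powersetCard, (hH Q hQ).1, hk])
    (fun u v huv => by
      have := hcodeg_powersetCard_le (r := r) H (fun Q hQ => (hH Q hQ).1) (by omega) huv
      rwa [hm, Nat.add_sub_cancel] at this)
    (fun e he => by
      have h1 : hdeg H (powersetCard r) e = #{Q ∈ H | e ⊆ Q} := by
        unfold hdeg
        simp only [mem_powersetCard, hGr e he, and_true]
      rw [h1]
      refine (hreg e he).trans (mul_le_mul_of_nonneg_right ?_ hDpos.le)
      linarith)
    (fun f hf => by
      have h1 := card_filter_superset_le G f hGr
      rw [(mem_powersetCard.1 hf).2, show r - (r - 1) = 1 by omega, pow_one] at h1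
      rw [hx]
      exact_mod_cast (Finset.card_le_card inter_subset_right).trans h1)
    (by
      rw [← Real.rpow_add hx0, show a + t + -a = t by ring]
      refine lt_of_le_of_lt ?_ e6
      rw [show -(x ^ t / 4) = -(1 / 4) * x ^ t by ring]
      refine mul_le_mul_of_nonneg_right ?_ (Real.exp_pos _).le
      linarith)
  refine ⟨M, hMH, ?_, fun f hf => ?_⟩
  · rintro Q hQ Q' hQ' hne e he ⟨h1, h2⟩
    exact Finset.disjoint_left.1 (hMd Q hQ Q' hQ' hne) (mem_powersetCard.2 ⟨h1, he⟩)
      (mem_powersetCard.2 ⟨h2, he⟩)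
  · have h1 := hMc f (mem_powersetCard.2 ⟨subset_univ _, hf⟩)
    rw [sub_eq_add_neg, Real.rpow_add hx0, Real.rpow_one]
    refine le_trans ?_ h1
    refine Nat.cast_le.2 (Finset.card_le_card fun e he => ?_)
    simp only [mem_filter, mem_inter, mem_sdiff, mem_biUnion, mem_powersetCard] at he ⊢
    exact ⟨⟨he.1, fun ⟨Q, hQ, h, _⟩ => he.2.2 Q hQ h⟩, he.1, he.2.1⟩
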